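/- Let n ≥ 1 and let K ⊆ ℂⁿ be a compact set that is meromorphically convex, i.e. for every point z ∈ ℂⁿ \ K there exists an entire function f : ℂⁿ → ℂ with f(z) = 0 and f(x) ≠ 0 for every x ∈ K. Let H ⊆ ℂⁿ be a compact set whose 2-dimensional Hausdorff measure is zero, μH[2](H) = 0. Then the union K ∪ H is meromorphically convex: for every z ∈ ℂⁿ \ (K ∪ H) there exists an entire function g : ℂⁿ → ℂ with g(z) = 0 and g(x) ≠ 0 for every x ∈ K ∪ H. -/

import Mathlib

open MeasureTheory

noncomputable instance euclideanComplexMeasurableSpace (n : ℕ) :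
    MeasurableSpace (EuclideanSpace ℂ (Fin n)) := borel _

instance euclideanComplexBorelSpace (n : ℕ) :
    BorelSpace (EuclideanSpace ℂ (Fin n)) := ⟨rfl⟩

/-- An entire function is Lipschitz on every ball around the origin. -/
lemma entire_lipschitz_aux {n : ℕ} (g : EuclideanSpace ℂ (Fin n) → ℂ)
    (hg : Differentiable ℂ g) (R : ℝ) :
    ∃ C M : ℝ, 0 ≤ C ∧ 0 ≤ M ∧ (∀ x ∈ Metric.ball (0 : EuclideanSpace ℂ (Fin n)) R, ‖g x‖ ≤ M) ∧
      ∀ x ∈ Metric.ball (0 : EuclideanSpace ℂ (Fin n)) R,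
      ∀ y ∈ Metric.ball (0 : EuclideanSpace ℂ (Fin n)) R, ‖g y - g x‖ ≤ C * ‖y - x‖ := by
  obtain ⟨M, hM⟩ := (isCompact_closedBall (0 : EuclideanSpace ℂ (Fin n))
    (R + 1)).exists_bound_of_continuousOn hg.continuous.continuousOn
  have hM' : ∀ x ∈ Metric.closedBall (0 : EuclideanSpace ℂ (Fin n)) (R + 1), ‖g x‖ ≤ |M| :=
    fun x hx => (hM x hx).trans (le_abs_self M)
  refine ⟨2 * |M| + 1, |M|, by positivity, by positivity, ?_, ?_⟩
  · intro x hx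
    apply hM'
    simp only [Metric.mem_ball, Metric.mem_closedBall] at *
    linarith
  · intro x hx y hy
    refine Convex.norm_image_sub_le_of_norm_fderiv_le (𝕜 := ℂ) (fun x _ => hg x) ?_
      (convex_ball _ R) hx hy
    intro c hc
    have := Complex.norm_fderiv_le_div_of_mapsTo_ball (f := g) (c := c) (R₁ := 1)
      (R₂ := 2 * |M| + 1) hg.differentiableOn ?_ one_pos
    · simpa using this
    · intro u hu
      have h1 : ‖g u‖ ≤ |M| := by
        apply hM'
        simp only [Metric.mem_ball, Metric.mem_closedBall] at *
        linarith [dist_triangle u c 0]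
      have h2 : ‖g c‖ ≤ |M| := by
        apply hM'
        simp only [Metric.mem_ball, Metric.mem_closedBall] at *
        linarith
      rw [Metric.mem_closedBall, dist_eq_norm]
      linarith [norm_sub_le (g u) (g c)]

/-- One perturbation step in the direction of the `i`-th coordinate. -/
lemma perturb_step_aux {n : ℕ} (z : EuclideanSpace ℂ (Fin n))
    (L H : Set (EuclideanSpace ℂ (Fin n))) (hL : IsCompact L) (hH : IsCompact H)
    (hHnull : μH[2] H = 0) (i : Fin n) (δ : ℝ) (hδ : 0 < δ)
    (hHi : ∀ x ∈ H, δ ≤ ‖x i - z i‖)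
    (g : EuclideanSpace ℂ (Fin n) → ℂ)
    (hg : Differentiable ℂ g) (hgz : g z = 0) (hgL : ∀ x ∈ L, g x ≠ 0) :
    ∃ f : EuclideanSpace ℂ (Fin n) → ℂ,
      Differentiable ℂ f ∧ f z = 0 ∧ ∀ x ∈ L ∪ H, f x ≠ 0 := by
  -- lower bound of `g` on `L`
  have hlow : ∃ m > 0, ∀ x ∈ L, m ≤ ‖g x‖ := by
    rcases L.eq_empty_or_nonempty with rfl | hne
    · exact ⟨1, one_pos, by simp⟩
    · obtain ⟨x₀, hx₀, hmin⟩ := hL.exists_isMinOn hne hg.continuous.norm.continuousOn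
      exact ⟨‖g x₀‖, norm_pos_iff.mpr (hgL x₀ hx₀), fun x hx => hmin hx⟩
  obtain ⟨m, hm, hmL⟩ := hlow
  have hcoord : Differentiable ℂ (fun x : EuclideanSpace ℂ (Fin n) => x i - z i) := by
    fun_prop
  obtain ⟨B, hB⟩ := hL.exists_bound_of_continuousOn hcoord.continuous.continuousOn
  have hB' : ∀ x ∈ L, ‖x i - z i‖ ≤ |B| := fun x hx => (hB x hx).trans (le_abs_self B)
  -- the bad set of parameters
  let F : EuclideanSpace ℂ (Fin n) → ℂ := fun x => -(g x / (x i - z i))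
  obtain ⟨R, hR⟩ := hH.isBounded.subset_ball (0 : EuclideanSpace ℂ (Fin n))
  obtain ⟨C, M, hC, hM, hgM, hgC⟩ := entire_lipschitz_aux g hg R
  have hF : LipschitzOnWith (Real.toNNReal (C / δ + M / δ ^ 2)) F H := by
    refine LipschitzOnWith.of_dist_le_mul ?_
    intro x hx y hy
    rw [Real.coe_toNNReal _ (by positivity), dist_eq_norm, dist_eq_norm]
    have hax := hHi x hx
    have hay := hHi y hy
    have hx0 : x i - z i ≠ 0 := norm_pos_iff.mp (hδ.trans_le hax)
    have hy0 : y i - z i ≠ 0 := norm_pos_iff.mp (hδ.trans_le hay)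
    have key : F x - F y = (g y - g x) / (x i - z i)
        + g y * (x i - y i) / ((x i - z i) * (y i - z i)) := by
      simp only [F]
      field_simp
      ring
    have e1 : ‖g y - g x‖ ≤ C * ‖x - y‖ := by
      rw [norm_sub_rev x y]
      exact hgC x (hR hx) y (hR hy)
    have e2 : ‖x i - y i‖ ≤ ‖x - y‖ := by
      simpa using PiLp.norm_apply_le (x - y) i
    have e3 := hgM y (hR hy)
    rw [key]
    refine (norm_add_le _ _).trans ?_
    rw [norm_div, norm_div, norm_mul, norm_mul, add_mul]
    refine add_le_add ?_ ?_
    · calc ‖g y - g x‖ / ‖x i - z i‖ ≤ (C * ‖x - y‖) / δ := by gcongr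
        _ = C / δ * ‖x - y‖ := by ring
    · calc ‖g y‖ * ‖x i - y i‖ / (‖x i - z i‖ * ‖y i - z i‖)
          ≤ (M * ‖x - y‖) / (δ * δ) := by gcongr
        _ = M / δ ^ 2 * ‖x - y‖ := by ring
  have hnull : (μH[2] : Measure ℂ) (F '' H) = 0 := by
    have := hF.hausdorffMeasure_image_le (d := 2) (by norm_num)
    rw [hHnull, mul_zero] at this
    exact le_antisymm this zero_le
  have : Measure.IsAddHaarMeasure (μH[2] : Measure ℂ) := by
    have := isAddHaarMeasure_hausdorffMeasure (E := ℂ)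
    rw [Complex.finrank_real_complex] at this
    exact_mod_cast this
  -- choose a small good parameter
  have hr : 0 < m / (|B| + 1) := by positivity
  obtain ⟨w, hw, hwF⟩ : ∃ w ∈ Metric.ball (0 : ℂ) (m / (|B| + 1)), w ∉ F '' H := by
    by_contra! hcon
    have h1 := measure_mono_null (μ := (μH[2] : Measure ℂ)) (fun w hw => hcon w hw) hnull
    exact (Metric.measure_ball_pos (μH[2] : Measure ℂ) 0 hr).ne' h1
  refine ⟨fun x => g x + w * (x i - z i), hg.add (hcoord.const_mul w), by simp [hgz], ?_⟩
  rintro x (hx | hx) h0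
  · have h1 : ‖g x‖ = ‖w‖ * ‖x i - z i‖ := by
      rw [← norm_mul, ← norm_neg (w * _), eq_neg_of_add_eq_zero_left h0]
    have h2 : ‖w‖ < m / (|B| + 1) := by simpa using hw
    have h3 : ‖w‖ * (|B| + 1) < m := (lt_div_iff₀ (by positivity)).mp h2
    have h4 := mul_le_mul_of_nonneg_left (hB' x hx) (norm_nonneg w)
    linarith [hmL x hx, norm_nonneg w]
  · apply hwF
    have hx0 : x i - z i ≠ 0 := norm_pos_iff.mp (hδ.trans_le (hHi x hx))
    refine ⟨x, hx, ?_⟩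
    simp only [F]
    rw [← neg_div, div_eq_iff hx0]
    linear_combination -h0

/-- If `K ⊆ ℂⁿ` is a compact meromorphically convex set and `H ⊆ ℂⁿ` is a compact set of
2-dimensional Hausdorff measure zero, then `K ∪ H` is meromorphically convex. -/
theorem union_meromorphically_convex (n : ℕ) (hn : 1 ≤ n)
    (K H : Set (EuclideanSpace ℂ (Fin n)))
    (hK : IsCompact K) (hH : IsCompact H)
    (hKconv : ∀ z ∉ K, ∃ f : EuclideanSpace ℂ (Fin n) → ℂ,
      Differentiable ℂ f ∧ f z = 0 ∧ ∀ x ∈ K, f x ≠ 0)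
    (hHnull : μH[2] H = 0) :
    ∀ z ∉ K ∪ H, ∃ g : EuclideanSpace ℂ (Fin n) → ℂ,
      Differentiable ℂ g ∧ g z = 0 ∧ ∀ x ∈ K ∪ H, g x ≠ 0 := by
  intro z hz
  rw [Set.mem_union, not_or] at hz
  -- a uniform lower bound for some coordinate
  have hδ : ∃ δ > 0, ∀ x ∈ H, ∃ i, δ ≤ ‖x i - z i‖ := by
    let N : EuclideanSpace ℂ (Fin n) → ℝ := fun x => ‖fun i => x i - z i‖
    have hN : Continuous N := by
      simp only [N]
      fun_prop
    rcases H.eq_empty_or_nonempty with rfl | hne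
    · exact ⟨1, one_pos, by simp⟩
    · obtain ⟨x₀, hx₀, hmin⟩ := hH.exists_isMinOn hne hN.continuousOn
      have hpos : 0 < N x₀ := by
        refine norm_pos_iff.mpr fun h => hz.2 ?_
        have : x₀ = z := by
          ext i
          exact sub_eq_zero.mp (congrFun h i)
        exact this ▸ hx₀
      refine ⟨N x₀, hpos, fun x hx => ?_⟩
      by_contra! hcon
      have h1 : N x < N x₀ := (pi_norm_lt_iff hpos).mpr hcon
      exact absurd (hmin hx) (not_le.mpr h1)
  obtain ⟨δ, hδ, hcov⟩ := hδ
  have hHi : ∀ i, IsCompact {x ∈ H | δ ≤ ‖x i - z i‖} := fun i =>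
    hH.inter_right (t := {x : EuclideanSpace ℂ (Fin n) | δ ≤ ‖x i - z i‖})
      (isClosed_le continuous_const (by fun_prop))
  have main : ∀ s : Finset (Fin n), ∃ g : EuclideanSpace ℂ (Fin n) → ℂ,
      Differentiable ℂ g ∧ g z = 0 ∧
        ∀ x ∈ K ∪ ⋃ i ∈ s, {x ∈ H | δ ≤ ‖x i - z i‖}, g x ≠ 0 := by
    intro s
    induction s using Finset.induction_on with
    | empty => simpa using hKconv z hz.1
    | insert a s _ ih =>
      obtain ⟨g, hg, hgz, hgL⟩ := ih
      obtain ⟨f, hf, hfz, hfL⟩ := perturb_step_aux z _ {x ∈ H | δ ≤ ‖x a - z a‖}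
        (hK.union (s.isCompact_biUnion fun i _ => hHi i)) (hHi a)
        (measure_mono_null (fun x hx => hx.1) hHnull) a δ hδ (fun x hx => hx.2) g hg hgz hgL
      refine ⟨f, hf, hfz, fun x hx => hfL x ?_⟩
      rw [Finset.set_biUnion_insert] at hx
      rcases hx with h | h | h
      · exact Or.inl (Or.inl h)
      · exact Or.inr h
      · exact Or.inl (Or.inr h)
  obtain ⟨g, hg, hgz, hgL⟩ := main Finset.univ
  refine ⟨g, hg, hgz, fun x hx => hgL x ?_⟩
  rcases hx with hx | hx
  · exact Or.inl hx
  · obtain ⟨i, hi⟩ := hcov x hx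
    exact Or.inr (Set.mem_biUnion (Finset.mem_coe.mpr (Finset.mem_univ i)) ⟨hx, hi⟩)
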